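/- For every gauge parameter λ (smooth, symmetric, η-traceless), the Einstein tensor of the pure gauge field (δ_λ h)_{μνρ} := ∂_μ λ_{νρ} + ∂_ν λ_{ρμ} + ∂_ρ λ_{μν} vanishes identically: G[δ_λ h]_{μνρ}(x) = 0 for all x ∈ ℝⁿ and all μ, ν, ρ. In other words, the equations of motion of the free spin-3 theory are gauge invariant. -/

import Mathlib

open MeasureTheory

noncomputable section

/-- Mostly-plus Minkowski metric `η_{μν} = diag(−1,+1,…,+1)` on `ℝⁿ`
(it coincides with its inverse `η^{μν}`). -/
def eta (n : ℕ) (μ ν : Fin n) : ℝ :=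
  if μ = ν then (if (μ : ℕ) = 0 then -1 else 1) else 0

/-- Partial derivative `∂_μ` of a scalar function on `ℝⁿ`. -/
def pd {n : ℕ} (μ : Fin n) (f : (Fin n → ℝ) → ℝ) : (Fin n → ℝ) → ℝ :=
  fun x => fderiv ℝ f x (Pi.single μ 1)

/-- A rank-3 covariant tensor field on `ℝⁿ` (the type of spin-3 fields). -/
abbrev Spin3 (n : ℕ) := (Fin n → ℝ) → Fin n → Fin n → Fin n → ℝ

/-- Trace `h_μ := η^{νρ} h_{μνρ}`. -/
def trH {n : ℕ} (h : Spin3 n) (x : Fin n → ℝ) (μ : Fin n) : ℝ :=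
  ∑ ν, ∑ ρ, eta n ν ρ * h x μ ν ρ

/-- Fronsdal tensor
`F_{μνρ} := □h_{μνρ} − ∂^σ(∂_μ h_{νρσ} + ∂_ν h_{ρμσ} + ∂_ρ h_{μνσ})
  + ∂_μ∂_ν h_ρ + ∂_ν∂_ρ h_μ + ∂_ρ∂_μ h_ν`. -/
def fronsdal {n : ℕ} (h : Spin3 n) (x : Fin n → ℝ) (μ ν ρ : Fin n) : ℝ :=
  (∑ σ, ∑ τ, eta n σ τ * pd σ (pd τ (fun y => h y μ ν ρ)) x)
  - (∑ σ, ∑ τ, eta n σ τ *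
      pd τ (fun y => pd μ (fun z => h z ν ρ σ) y + pd ν (fun z => h z ρ μ σ) y
        + pd ρ (fun z => h z μ ν σ) y) x)
  + pd μ (pd ν (fun z => trH h z ρ)) x
  + pd ν (pd ρ (fun z => trH h z μ)) x
  + pd ρ (pd μ (fun z => trH h z ν)) x

/-- Trace of the Fronsdal tensor, `F_ρ := η^{μν} F_{μνρ}`. -/
def trF {n : ℕ} (h : Spin3 n) (x : Fin n → ℝ) (ρ : Fin n) : ℝ :=
  ∑ μ, ∑ ν, eta n μ ν * fronsdal h x μ ν ρ

/-- Einstein tensor `G_{μνρ} := F_{μνρ} − (1/2)(η_{μν}F_ρ + η_{νρ}F_μ + η_{ρμ}F_ν)`. -/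
def einstein {n : ℕ} (h : Spin3 n) (x : Fin n → ℝ) (μ ν ρ : Fin n) : ℝ :=
  fronsdal h x μ ν ρ
    - (1/2) * (eta n μ ν * trF h x ρ + eta n ν ρ * trF h x μ + eta n ρ μ * trF h x ν)

/-- Gauge transformation `(δ_λ h)_{μνρ} := ∂_μ λ_{νρ} + ∂_ν λ_{ρμ} + ∂_ρ λ_{μν}`. -/
def gaugeTransform {n : ℕ} (lam : (Fin n → ℝ) → Fin n → Fin n → ℝ) : Spin3 n :=
  fun x μ ν ρ => pd μ (fun y => lam y ν ρ) x + pd ν (fun y => lam y ρ μ) x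
    + pd ρ (fun y => lam y μ ν) x

/-- Curvature tensor `K_{αμ|βν|γρ}`: the antisymmetrization of `∂_α∂_β∂_γ h_{μνρ}`
in each of the index pairs `(α,μ)`, `(β,ν)`, `(γ,ρ)`. -/
def curvature {n : ℕ} (h : Spin3 n) (x : Fin n → ℝ) (α μ β ν γ ρ : Fin n) : ℝ :=
  pd α (pd β (pd γ (fun y => h y μ ν ρ))) x
  - pd μ (pd β (pd γ (fun y => h y α ν ρ))) x
  - pd α (pd ν (pd γ (fun y => h y μ β ρ))) x
  - pd α (pd β (pd ρ (fun y => h y μ ν γ))) x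
  + pd μ (pd ν (pd γ (fun y => h y α β ρ))) x
  + pd μ (pd β (pd ρ (fun y => h y α ν γ))) x
  + pd α (pd ν (pd ρ (fun y => h y μ β γ))) x
  - pd μ (pd ν (pd ρ (fun y => h y α β γ))) x

/-- The free Fronsdal Lagrangian density for a single spin-3 field (all
contractions performed with the Minkowski metric `η`). -/
def lag {n : ℕ} (h : Spin3 n) (x : Fin n → ℝ) : ℝ :=
  -(1/2) * (∑ σ, ∑ τ, ∑ μ, ∑ μ', ∑ ν, ∑ ν', ∑ ρ, ∑ ρ',
      eta n σ τ * eta n μ μ' * eta n ν ν' * eta n ρ ρ' *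
        pd σ (fun y => h y μ ν ρ) x * pd τ (fun y => h y μ' ν' ρ') x)
  + (3/2) * (∑ μ, ∑ μ', ∑ ν, ∑ ν', ∑ ρ, ∑ ρ', ∑ σ, ∑ σ',
      eta n μ μ' * eta n ν ν' * eta n ρ ρ' * eta n σ σ' *
        pd μ' (fun y => h y μ ρ σ) x * pd ν (fun y => h y ν' ρ' σ') x)
  + (3/2) * (∑ μ, ∑ μ', ∑ ν, ∑ ν',
      eta n μ μ' * eta n ν ν' * pd μ (fun y => trH h y ν) x * pd μ' (fun y => trH h y ν') x)
  + (3/4) * (∑ μ, ∑ μ', ∑ ν, ∑ ν',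
      eta n μ μ' * eta n ν ν' * pd μ (fun y => trH h y μ') x * pd ν (fun y => trH h y ν') x)
  - 3 * (∑ μ, ∑ μ', ∑ ν, ∑ ν', ∑ ρ, ∑ ρ',
      eta n μ μ' * eta n ν ν' * eta n ρ ρ' *
        pd μ (fun y => trH h y ν) x * pd ρ (fun y => h y ρ' μ' ν') x)

/-- The free spin-3 (Fronsdal) action for a single field. -/
def action {n : ℕ} (h : Spin3 n) : ℝ := ∫ x : Fin n → ℝ, lag h x

lemma sum_eta_mul {n : ℕ} (σ : Fin n) (f : Fin n → ℝ) :
    ∑ τ, eta n σ τ * f τ = eta n σ σ * f σ :=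
  Finset.sum_eq_single σ (fun τ _ h => by simp [eta, h.symm]) (by simp)

lemma contDiff_pd {n : ℕ} (μ : Fin n) {f : (Fin n → ℝ) → ℝ}
    (hf : ContDiff ℝ (⊤ : ℕ∞) f) : ContDiff ℝ (⊤ : ℕ∞) (pd μ f) :=
  (hf.fderiv_right (m := (⊤ : ℕ∞)) (by simp)).clm_apply contDiff_const

lemma pd_zero {n : ℕ} (μ : Fin n) : pd μ (fun _ => (0 : ℝ)) = fun _ => 0 := by
  funext x
  simp [pd]

lemma pd_add {n : ℕ} (μ : Fin n) {f g : (Fin n → ℝ) → ℝ}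
    (hf : ContDiff ℝ (⊤ : ℕ∞) f) (hg : ContDiff ℝ (⊤ : ℕ∞) g) :
    pd μ (fun x => f x + g x) = fun x => pd μ f x + pd μ g x := by
  funext x
  simp only [pd]
  rw [fderiv_fun_add (hf.differentiable (by simp) x) (hg.differentiable (by simp) x)]
  rfl

lemma pd_const_mul {n : ℕ} (μ : Fin n) (c : ℝ) {f : (Fin n → ℝ) → ℝ}
    (hf : ContDiff ℝ (⊤ : ℕ∞) f) :
    pd μ (fun x => c * f x) = fun x => c * pd μ f x := by
  funext x
  simp only [pd]
  rw [fderiv_const_mul (hf.differentiable (by simp) x)]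
  rfl

lemma pd_sum {n : ℕ} (μ : Fin n) {ι : Type*} (s : Finset ι) {f : ι → (Fin n → ℝ) → ℝ}
    (hf : ∀ i, ContDiff ℝ (⊤ : ℕ∞) (f i)) :
    pd μ (fun x => ∑ i ∈ s, f i x) = fun x => ∑ i ∈ s, pd μ (f i) x := by
  funext x
  simp only [pd]
  rw [fderiv_fun_sum fun i _ => (hf i).differentiable (by simp) x]
  simp

lemma pd_comm {n : ℕ} (μ ν : Fin n) {f : (Fin n → ℝ) → ℝ}
    (hf : ContDiff ℝ (⊤ : ℕ∞) f) : pd μ (pd ν f) = pd ν (pd μ f) := by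
  have h2 : Differentiable ℝ (fderiv ℝ f) :=
    (hf.fderiv_right (m := (⊤ : ℕ∞)) (by simp)).differentiable (by simp)
  have key : ∀ (a b : Fin n) (x : Fin n → ℝ), pd a (pd b f) x =
      fderiv ℝ (fderiv ℝ f) x (Pi.single a 1) (Pi.single b 1) := by
    intro a b x
    change fderiv ℝ (fun y => fderiv ℝ f y (Pi.single b 1)) x (Pi.single a 1) = _
    rw [fderiv_clm_apply (h2 x) (differentiableAt_const _)]
    simp
  funext x
  rw [key, key]
  have hf2 : ContDiff ℝ 2 f := hf.of_le (WithTop.coe_le_coe.2 le_top)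
  exact (hf2.contDiffAt.isSymmSndFDerivAt (by simp)) _ _

/-- The trace of a pure gauge field is twice the divergence of its traceless parameter. -/
lemma trH_gaugeTransform {n : ℕ} {lam : (Fin n → ℝ) → Fin n → Fin n → ℝ}
    (lsmooth : ∀ μ ν : Fin n, ContDiff ℝ (⊤ : ℕ∞) fun x => lam x μ ν)
    (lsym : ∀ x μ ν, lam x μ ν = lam x ν μ)
    (ltraceless : ∀ x, ∑ μ, ∑ ν, eta n μ ν * lam x μ ν = 0) (x : Fin n → ℝ) (μ : Fin n) :
    trH (gaugeTransform lam) x μ = ∑ σ, 2 * eta n σ σ * pd σ (fun y => lam y σ μ) x := by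
  have htr : ∑ σ, eta n σ σ * pd μ (fun y => lam y σ σ) x = 0 := by
    have h0 : (fun y => ∑ σ, eta n σ σ * lam y σ σ) = fun _ => 0 := by
      funext y
      simpa only [sum_eta_mul] using ltraceless y
    have h1 := congrFun (congrArg (pd μ) h0) x
    rw [pd_zero, pd_sum _ _ fun i => contDiff_const.mul (lsmooth i i)] at h1
    simpa only [pd_const_mul _ _ (lsmooth _ _)] using h1
  simp only [trH, gaugeTransform, sum_eta_mul]
  rw [← sub_eq_zero, ← Finset.sum_sub_distrib, ← htr]
  refine Finset.sum_congr rfl fun σ _ => ?_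
  simp only [lsym _ μ σ]
  ring

/-- The Fronsdal tensor of a pure gauge field with traceless parameter vanishes. -/
lemma fronsdal_gaugeTransform {n : ℕ} {lam : (Fin n → ℝ) → Fin n → Fin n → ℝ}
    (lsmooth : ∀ μ ν : Fin n, ContDiff ℝ (⊤ : ℕ∞) fun x => lam x μ ν)
    (lsym : ∀ x μ ν, lam x μ ν = lam x ν μ)
    (ltraceless : ∀ x, ∑ μ, ∑ ν, eta n μ ν * lam x μ ν = 0)
    (x : Fin n → ℝ) (μ ν ρ : Fin n) : fronsdal (gaugeTransform lam) x μ ν ρ = 0 := by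
  have h1 (a i j : Fin n) := contDiff_pd a (lsmooth i j)
  have h2 (a b i j : Fin n) := contDiff_pd a (h1 b i j)
  have hgauge (a b c d : Fin n) : pd a (fun y => gaugeTransform lam y b c d) = fun y =>
      pd a (pd b fun z => lam z c d) y + pd a (pd c fun z => lam z d b) y
        + pd a (pd d fun z => lam z b c) y := by
    simp only [gaugeTransform]
    rw [pd_add a ((h1 b c d).add (h1 c d b)) (h1 d b c), pd_add a (h1 b c d) (h1 c d b)]
  have hgauge_smooth (a b c d : Fin n) :
      ContDiff ℝ (⊤ : ℕ∞) (pd a (fun y => gaugeTransform lam y b c d)) :=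
    contDiff_pd a (((h1 b c d).add (h1 c d b)).add (h1 d b c))
  have hgauge₂ (e a b c d : Fin n) :
      pd e (pd a (fun y => gaugeTransform lam y b c d)) x =
        pd e (pd a (pd b fun z => lam z c d)) x + pd e (pd a (pd c fun z => lam z d b)) x
          + pd e (pd a (pd d fun z => lam z b c)) x := by
    rw [hgauge, pd_add e ((h2 a b c d).add (h2 a c d b)) (h2 a d b c),
      pd_add e (h2 a b c d) (h2 a c d b)]
  have htrace (a b c : Fin n) : pd a (pd b (fun z => trH (gaugeTransform lam) z c)) x =
      ∑ σ, 2 * eta n σ σ * pd a (pd b (pd σ fun y => lam y σ c)) x := by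
    simp only [trH_gaugeTransform lsmooth lsym ltraceless]
    rw [pd_sum _ _ fun i => contDiff_const.mul (h1 i i c)]
    simp only [pd_const_mul _ _ (h1 _ _ _)]
    rw [pd_sum _ _ fun i => contDiff_const.mul (h2 b i i c)]
    simp only [pd_const_mul _ _ (h2 _ _ _ _)]
  have hdiv (σ : Fin n) :
      pd σ (fun y => pd μ (fun z => gaugeTransform lam z ν ρ σ) y
        + pd ν (fun z => gaugeTransform lam z ρ μ σ) y
        + pd ρ (fun z => gaugeTransform lam z μ ν σ) y) x =
      pd σ (pd μ fun z => gaugeTransform lam z ν ρ σ) x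
        + pd σ (pd ν fun z => gaugeTransform lam z ρ μ σ) x
        + pd σ (pd ρ fun z => gaugeTransform lam z μ ν σ) x := by
    rw [pd_add σ ((hgauge_smooth _ _ _ _).add (hgauge_smooth _ _ _ _)) (hgauge_smooth _ _ _ _),
      pd_add σ (hgauge_smooth _ _ _ _) (hgauge_smooth _ _ _ _)]
  simp only [fronsdal, sum_eta_mul, hdiv, hgauge₂, htrace]
  rw [← Finset.sum_sub_distrib, ← Finset.sum_add_distrib, ← Finset.sum_add_distrib,
    ← Finset.sum_add_distrib]
  refine Finset.sum_eq_zero fun σ _ => ?_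
  have c12 (a b c i j : Fin n) : pd a (pd b (pd c fun y => lam y i j)) x =
      pd b (pd a (pd c fun y => lam y i j)) x := by
    rw [pd_comm a b (h1 c i j)]
  have c23 (a b c i j : Fin n) : pd a (pd b (pd c fun y => lam y i j)) x =
      pd a (pd c (pd b fun y => lam y i j)) x := by
    rw [pd_comm b c (lsmooth i j)]
  have sym (i j : Fin n) : (fun y => lam y i j) = fun y => lam y j i :=
    funext fun y => lsym y i j
  rw [sym ρ σ, sym μ σ, sym ν σ, c23 μ ν σ, c12 μ σ ν, c23 ν ρ σ, c12 ν σ ρ,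
    c23 ρ μ σ, c12 ρ σ μ, c23 σ ν μ, c23 σ ρ ν, c23 σ μ ρ,
    c23 σ μ σ, c23 σ ν σ, c23 σ ρ σ]
  ring

/-- **Gauge invariance of the spin-3 equations of motion.**  For every gauge
parameter `λ` (smooth, symmetric, `η`-traceless) the Einstein tensor of the pure
gauge field `δ_λ h` vanishes identically. -/
theorem einstein_gauge_invariant (n : ℕ) (hn : 1 ≤ n)
    (lam : (Fin n → ℝ) → Fin n → Fin n → ℝ)
    (lsmooth : ∀ μ ν : Fin n, ContDiff ℝ (⊤ : ℕ∞) fun x => lam x μ ν)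
    (lsym : ∀ x μ ν, lam x μ ν = lam x ν μ)
    (ltraceless : ∀ x, ∑ μ, ∑ ν, eta n μ ν * lam x μ ν = 0) :
    ∀ x μ ν ρ, einstein (gaugeTransform lam) x μ ν ρ = 0 := by
  intro x μ ν ρ
  simp [einstein, trF, fronsdal_gaugeTransform lsmooth lsym ltraceless]
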